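/- Let n, a, c be positive integers with a ≥ 3. There exists an n-vertex co-polyunsaturated SGK graph G with independence number a and clique number c if and only if all of the following hold: (1) c ≥ a - 2; (2) n ≥ c + 1 + binom(a-1, 2); (3) n ≤ a·c + 1 - binom(a-1, 2). Moreover, G may be chosen so that both G and its complement are comparability graphs. -/

import Mathlib

/-- `s` is an independent set of the graph `G`. -/
def IndepSet {V : Type*} (G : SimpleGraph V) (s : Set V) : Prop :=
  ∀ ⦃v⦄, v ∈ s → ∀ ⦃w⦄, w ∈ s → ¬ G.Adj v w

/-- `α_k(G)`: the maximum number of vertices in a union of `k` independent sets. -/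
noncomputable def alphak {V : Type*} (G : SimpleGraph V) (k : ℕ) : ℕ :=
  sSup {n | ∃ A : Fin k → Set V, (∀ i, IndepSet G (A i)) ∧ (⋃ i, A i).ncard = n}

/-- `ω_k(G)`: the maximum number of vertices in a union of `k` cliques. -/
noncomputable def omegak {V : Type*} (G : SimpleGraph V) (k : ℕ) : ℕ :=
  sSup {n | ∃ A : Fin k → Set V, (∀ i, G.IsClique (A i)) ∧ (⋃ i, A i).ncard = n}

/-- The clique number `ω(G)`. -/
noncomputable def cliqueNumber {V : Type*} (G : SimpleGraph V) : ℕ :=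
  sSup {n | ∃ s : Set V, G.IsClique s ∧ s.ncard = n}

/-- The independence number `α(G)`. -/
noncomputable def indepNumber {V : Type*} (G : SimpleGraph V) : ℕ :=
  sSup {n | ∃ s : Set V, IndepSet G s ∧ s.ncard = n}

/-- `f` encodes a partition of the vertices of `G` into cliques:
its (nonempty) fibers are the cliques. -/
def IsCliquePartition {V : Type*} (G : SimpleGraph V) (f : V → V) : Prop :=
  ∀ i : V, G.IsClique (f ⁻¹' {i})

/-- The `k`-norm of the partition encoded by `f`: `Σ_C min (k, |C|)`. -/
noncomputable def knorm {V : Type*} [Fintype V] (f : V → V) (k : ℕ) : ℕ :=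
  ∑ i : V, min k (f ⁻¹' {i}).ncard

/-- `G` is a strong Greene–Kleitman (SGK) graph: every induced subgraph has, for every
positive `k`, a clique partition that is simultaneously `k`- and `k+1`-saturated. -/
def SGK {V : Type*} [Fintype V] (G : SimpleGraph V) : Prop :=
  ∀ (s : Finset V) (k : ℕ), 0 < k →
    ∃ f : (↑s : Set V) → (↑s : Set V),
      IsCliquePartition (G.induce ↑s) f ∧
      knorm f k = alphak (G.induce ↑s) k ∧
      knorm f (k + 1) = alphak (G.induce ↑s) (k + 1)

/-- An SGK graph is polyunsaturated if no clique partition is simultaneously `k`- and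
`l`-saturated for distinct nonconsecutive positive `k, l` below the clique number. -/
def PolyunsatG {V : Type*} [Fintype V] (G : SimpleGraph V) : Prop :=
  ∀ k l : ℕ, 0 < k → 0 < l → k < cliqueNumber G → l < cliqueNumber G →
    (k + 2 ≤ l ∨ l + 2 ≤ k) →
    ¬ ∃ f : V → V, IsCliquePartition G f ∧ knorm f k = alphak G k ∧ knorm f l = alphak G l

/-- `G` is a comparability graph: adjacency is comparability in some partial order. -/
def IsComparabilityGraph {V : Type*} (G : SimpleGraph V) : Prop :=
  ∃ r : V → V → Prop, IsPartialOrder V r ∧ ∀ v w, G.Adj v w ↔ (v ≠ w ∧ (r v w ∨ r w v))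


/-- `F` is a union of `k` independent sets of `G`. -/
def IsKFamily {V : Type*} (G : SimpleGraph V) (k : ℕ) (F : Set V) : Prop :=
  ∃ A : Fin k → Set V, (∀ i, IndepSet G (A i)) ∧ ⋃ i, A i = F

section Families

variable {V : Type*} {G : SimpleGraph V} {k : ℕ}

lemma IsKFamily.ncard_inter_le {F K : Set V} (hF : IsKFamily G k F) (hK : G.IsClique K) :
    (F ∩ K).ncard ≤ k := by
  classical
  obtain ⟨A, hA, rfl⟩ := hF
  rcases Nat.eq_zero_or_pos k with rfl | hk
  · simp
  have : Nonempty (Fin k) := ⟨⟨0, hk⟩⟩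
  have h : ∀ v : V, v ∈ (⋃ i, A i) ∩ K → ∃ i, v ∈ A i := fun v hv => by simpa using hv.1
  choose! c hc using h
  have := Set.ncard_le_ncard_of_injOn (s := (⋃ i, A i) ∩ K) (t := (Set.univ : Set (Fin k))) c
    (fun _ _ => Set.mem_univ _) (by
      intro v hv w hw hvw
      by_contra hne
      exact hA (c v) (hc v hv) (hvw ▸ hc w hw) (hK hv.2 hw.2 hne))
  simpa using this

variable [Fintype V]

lemma ncard_le_fintype_card (F : Set V) : F.ncard ≤ Fintype.card V := by
  rw [← Nat.card_eq_fintype_card, ← Set.ncard_univ]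
  exact Set.ncard_le_ncard (Set.subset_univ F)

lemma IsKFamily.ncard_le_alphak {F : Set V} (hF : IsKFamily G k F) : F.ncard ≤ alphak G k := by
  obtain ⟨A, hA, rfl⟩ := hF
  refine le_csSup ⟨Fintype.card V, ?_⟩ ⟨A, hA, rfl⟩
  rintro _ ⟨B, -, rfl⟩
  exact ncard_le_fintype_card _

lemma exists_isKFamily_ncard_eq_alphak (G : SimpleGraph V) (k : ℕ) :
    ∃ F : Set V, IsKFamily G k F ∧ F.ncard = alphak G k := by
  have h : alphak G k ∈
      {n | ∃ A : Fin k → Set V, (∀ i, IndepSet G (A i)) ∧ (⋃ i, A i).ncard = n} := by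
    refine Nat.sSup_mem ⟨0, fun _ => ∅, by simp [IndepSet], by simp⟩ ⟨Fintype.card V, ?_⟩
    rintro _ ⟨B, -, rfl⟩
    exact ncard_le_fintype_card _
  obtain ⟨A, hA, h⟩ := h
  exact ⟨_, ⟨A, hA, rfl⟩, h⟩

lemma ncard_eq_sum_fibers {β : Type*} (g : V → β) (S : Finset β) (hS : ∀ v, g v ∈ S)
    (F : Set V) : F.ncard = ∑ b ∈ S, (F ∩ g ⁻¹' {b}).ncard := by
  classical
  rw [Set.ncard_eq_toFinset_card' F,
    Finset.card_eq_sum_card_fiberwise (f := g) (t := S) (fun v _ => hS v)]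
  refine Finset.sum_congr rfl fun b _ => ?_
  rw [Set.ncard_eq_toFinset_card']
  congr 1
  ext v
  simp

lemma IsKFamily.ncard_inter_le_min {F K : Set V} (hF : IsKFamily G k F) (hK : G.IsClique K) :
    (F ∩ K).ncard ≤ min k K.ncard :=
  le_min (hF.ncard_inter_le hK) (Set.ncard_le_ncard Set.inter_subset_right)

lemma IsKFamily.ncard_le_knorm {F : Set V} (hF : IsKFamily G k F) {f : V → V}
    (hf : IsCliquePartition G f) : F.ncard ≤ knorm f k := by
  rw [ncard_eq_sum_fibers f Finset.univ (fun _ => Finset.mem_univ _), knorm]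
  exact Finset.sum_le_sum fun i _ => hF.ncard_inter_le_min (hf i)

lemma alphak_le_knorm {f : V → V} (hf : IsCliquePartition G f) (k : ℕ) :
    alphak G k ≤ knorm f k := by
  obtain ⟨F, hF, h⟩ := exists_isKFamily_ncard_eq_alphak G k
  exact h ▸ hF.ncard_le_knorm hf

lemma IsKFamily.ncard_inter_fiber_eq {F : Set V} (hF : IsKFamily G k F) {f : V → V}
    (hf : IsCliquePartition G f) (h : F.ncard = knorm f k) (i : V) :
    (F ∩ f ⁻¹' {i}).ncard = min k (f ⁻¹' {i}).ncard := by
  rw [ncard_eq_sum_fibers f Finset.univ (fun _ => Finset.mem_univ _), knorm] at h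
  exact (Finset.sum_eq_sum_iff_of_le fun i _ => hF.ncard_inter_le_min (hf i)).1 h i
    (Finset.mem_univ i)

end Families

section Duality

/-- Egerváry's theorem: an integral assignment problem admits an optimal permutation together
with integral potentials certifying its optimality. -/
theorem exists_perm_potentials {V : Type*} [Fintype V] (w : V → V → ℤ) :
    ∃ (σ : Equiv.Perm V) (a b : V → ℤ), (∀ v u, a v + b u ≤ w v u) ∧
      ∀ v, a v + b (σ v) = w v (σ v) := by
  classical
  let P : ℤ → Prop := fun s => ∃ a b : V → ℤ, (∀ v u, a v + b u ≤ w v u) ∧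
    ∑ v, a v + ∑ v, b v = s
  have hbdd : ∃ M : ℤ, ∀ s, P s → s ≤ M := by
    refine ⟨∑ v, w v v, ?_⟩
    rintro s ⟨a, b, hab, rfl⟩
    rw [← Finset.sum_add_distrib]
    exact Finset.sum_le_sum fun v _ => hab v v
  have hne : ∃ s, P s := by
    refine ⟨_, fun v => -∑ u, |w v u|, fun _ => 0, fun v u => ?_, rfl⟩
    have h1 : |w v u| ≤ ∑ u, |w v u| :=
      Finset.single_le_sum (f := fun u => |w v u|) (fun _ _ => abs_nonneg _) (Finset.mem_univ u)
    have h2 := neg_abs_le (w v u)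
    linarith
  obtain ⟨s, ⟨a, b, hab, hs⟩, hmax⟩ := Int.exists_greatest_of_bdd hbdd hne
  have hall : ∃ f : V → V, Function.Injective f ∧
      ∀ v, f v ∈ Finset.univ.filter fun u => a v + b u = w v u := by
    rw [← Finset.all_card_le_biUnion_card_iff_exists_injective]
    by_contra! hcon
    obtain ⟨S, hS⟩ := hcon
    set N := S.biUnion fun v => Finset.univ.filter fun u => a v + b u = w v u with hN
    have hP : P (s + (S.card - N.card)) := by
      refine ⟨fun v => a v + if v ∈ S then 1 else 0, fun u => b u - if u ∈ N then 1 else 0,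
        fun v u => ?_, ?_⟩
      · have h := hab v u
        dsimp only
        split_ifs with h1 h2 h2
        · linarith
        · have : a v + b u ≠ w v u := fun h => h2 (by
            rw [hN, Finset.mem_biUnion]
            exact ⟨v, h1, by simpa using h⟩)
          omega
        · linarith
        · linarith
      · rw [Finset.sum_add_distrib, Finset.sum_sub_distrib]
        simp only [Finset.sum_ite_mem, Finset.univ_inter, Finset.sum_const, nsmul_eq_mul, mul_one]
        linarith
    have := hmax _ hP
    omega
  obtain ⟨f, hinj, hf⟩ := hall
  refine ⟨Equiv.ofBijective f (Finite.injective_iff_bijective.1 hinj), a, b, hab, fun v => ?_⟩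
  simpa using hf v

end Duality

section GreeneKleitman

variable {V : Type*} [PartialOrder V]

lemma exists_not_lt_iterate [Finite V] (σ : Equiv.Perm V) (v : V) :
    ∃ i : ℕ, ¬ (σ ^ i) v < (σ ^ (i + 1)) v := by
  by_contra! h
  exact not_injective_infinite_finite _ (strictMono_nat_of_lt_succ h).injective

/-- The chains of `V` along which `σ` increases partition `V`, and the value of a vertex under
this map is the top of its chain. -/
lemma exists_ascent_partition [Finite V] (σ : Equiv.Perm V) :
    ∃ f : V → V, (∀ v, ¬ f v < σ (f v)) ∧ (∀ v u, f v = f u → v ≤ u ∨ u ≤ v) ∧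
      (∀ v, f (f v) = f v) ∧ ∀ v, σ (f v) = f v → v = f v := by
  classical
  have hlt : ∀ v i, i < Nat.find (exists_not_lt_iterate σ v) → (σ ^ i) v < (σ ^ (i + 1)) v :=
    fun v i hi => not_not.1 (Nat.find_min _ hi)
  have hle : ∀ v i, i ≤ Nat.find (exists_not_lt_iterate σ v) → v ≤ (σ ^ i) v := by
    intro v i
    induction i with
    | zero => simp
    | succ i ih => exact fun hi => (ih (by omega)).trans (hlt v i (by omega)).le
  have hcomp : ∀ v u, Nat.find (exists_not_lt_iterate σ v) ≤ Nat.find (exists_not_lt_iterate σ u) →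
      (σ ^ Nat.find (exists_not_lt_iterate σ v)) v = (σ ^ Nat.find (exists_not_lt_iterate σ u)) u →
      u ≤ v := by
    intro v u hvu h
    obtain ⟨d, hd⟩ := Nat.exists_eq_add_of_le hvu
    rw [hd, pow_add, Equiv.Perm.mul_apply, EmbeddingLike.apply_eq_iff_eq] at h
    rw [h]
    exact hle u d (by omega)
  have htop : ∀ v, ¬ (σ ^ Nat.find (exists_not_lt_iterate σ v)) v <
      σ ((σ ^ Nat.find (exists_not_lt_iterate σ v)) v) := by
    intro v
    have := Nat.find_spec (exists_not_lt_iterate σ v)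
    rwa [pow_succ', Equiv.Perm.mul_apply] at this
  refine ⟨fun v => (σ ^ Nat.find (exists_not_lt_iterate σ v)) v, htop, ?_, ?_, ?_⟩
  · intro v u h
    rcases le_total (Nat.find (exists_not_lt_iterate σ v))
      (Nat.find (exists_not_lt_iterate σ u)) with h' | h'
    · exact Or.inr (hcomp v u h' h)
    · exact Or.inl (hcomp u v h' h.symm)
  · intro v
    dsimp only
    generalize hu : (σ ^ Nat.find (exists_not_lt_iterate σ v)) v = u
    have h0 : Nat.find (exists_not_lt_iterate σ u) = 0 := by
      rw [Nat.find_eq_zero]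
      have := htop v
      rw [hu] at this
      simpa using this
    rw [h0]
    simp
  · intro v h
    dsimp only at h ⊢
    generalize Nat.find (exists_not_lt_iterate σ v) = i at h ⊢
    have hfix : ∀ j : ℕ, (σ ^ j) ((σ ^ i) v) = (σ ^ i) v := by
      intro j
      induction j with
      | zero => simp
      | succ j ih => rw [pow_succ, Equiv.Perm.mul_apply, h, ih]
    exact (σ ^ i).injective (hfix i).symm

/-- The Greene–Kleitman theorem: a finite poset has, for every positive `k`, a chain partition
that is simultaneously `k`- and `k+1`-saturated. -/
theorem exists_saturated_of_partialOrder [Fintype V] (G : SimpleGraph V)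
    (hG : ∀ v w, G.Adj v w ↔ v ≠ w ∧ (v ≤ w ∨ w ≤ v)) {k : ℕ} (hk : 0 < k) :
    ∃ f : V → V, IsCliquePartition G f ∧ knorm f k = alphak G k ∧
      knorm f (k + 1) = alphak G (k + 1) := by
  classical
  let w : V → V → ℤ := fun v u => if v = u then 2 else if v < u then 0 else 2 * k + 1
  obtain ⟨σ, a, b, hab, hσ⟩ := exists_perm_potentials w
  obtain ⟨f, htop, hchain, hidem, hfix⟩ := exists_ascent_partition σ
  have hf : IsCliquePartition G f := by
    intro i v hv u hu hne
    exact (hG v u).2 ⟨hne, hchain v u (hv.trans hu.symm)⟩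
  have hw0 : ∀ v u, 0 ≤ w v u := by
    intro v u
    dsimp only [w]
    split_ifs <;> omega
  have hwq : ∀ v u, w v u ≤ 2 * k + 1 := by
    intro v u
    dsimp only [w]
    split_ifs <;> omega
  have hcost : ((knorm f k + knorm f (k + 1) : ℕ) : ℤ) ≤ ∑ v, w v (σ v) := by
    rw [← Finset.sum_fiberwise Finset.univ f fun v => w v (σ v), knorm, knorm,
      ← Finset.sum_add_distrib]
    push_cast
    refine Finset.sum_le_sum fun t _ => ?_
    rcases (f ⁻¹' {t}).eq_empty_or_nonempty with he | ⟨v, hv⟩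
    · rw [he]
      have : 0 ≤ ∑ v with f v = t, w v (σ v) := Finset.sum_nonneg fun v _ => hw0 v (σ v)
      simp only [Set.ncard_empty]
      omega
    · have hv : f v = t := hv
      have htt : f t = t := by rw [← hv, hidem]
      have hle : w t (σ t) ≤ ∑ i with f i = t, w i (σ i) :=
        Finset.single_le_sum (f := fun v => w v (σ v)) (fun v _ => hw0 v (σ v)) (by simp [htt])
      by_cases hσt : σ t = t
      · have hsub : f ⁻¹' {t} ⊆ {t} := by
          intro u hu
          have hu : f u = t := hu
          have := hfix u (by rw [hu, hσt])
          rw [hu] at this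
          exact this
        have hc := Set.ncard_le_ncard hsub
        rw [Set.ncard_singleton] at hc
        have hwt : w t (σ t) = 2 := by simp [w, hσt]
        omega
      · have h1 : ¬ t < σ t := by
          have := htop v
          rwa [hv] at this
        have hwt : w t (σ t) = 2 * k + 1 := by
          dsimp only [w]
          rw [if_neg (Ne.symm hσt), if_neg h1]
        omega
  have hsum : ∑ v, w v (σ v) = ∑ v, (a v + b v) := by
    rw [Finset.sum_add_distrib, ← Equiv.sum_comp σ b, ← Finset.sum_add_distrib]
    exact Finset.sum_congr rfl fun v _ => (hσ v).symm
  obtain ⟨m, hmb, hma⟩ : ∃ m : ℤ, (∀ v, m ≤ -b v) ∧ ∀ v, a v ≤ m + (2 * k + 1) := by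
    rcases isEmpty_or_nonempty V with hV | hV
    · exact ⟨0, fun v => hV.elim v, fun v => hV.elim v⟩
    · obtain ⟨u, hu⟩ := Finite.exists_max b
      refine ⟨-b u, fun v => neg_le_neg (hu v), fun v => ?_⟩
      have := hab v u
      have := hwq v u
      linarith
  have hanti : ∀ t : ℤ, IndepSet G {v | -b v < t ∧ t ≤ a v} := by
    intro t
    have key : ∀ v u, -b v < t ∧ t ≤ a v → -b u < t ∧ t ≤ a u → ¬ v < u := by
      intro v u hv hu hlt
      have := hab v u
      simp only [w, if_neg hlt.ne, if_pos hlt] at this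
      linarith [hv.2, hu.1]
    intro v hv u hu hadj
    obtain ⟨hne, h | h⟩ := (hG v u).1 hadj
    · exact key v u hv hu (lt_of_le_of_ne h hne)
    · exact key u v hu hv (lt_of_le_of_ne h hne.symm)
  let F : ℕ → ℤ → Set V := fun j e => ⋃ i : Fin j, {v | -b v < m + e + 2 * i ∧ m + e + 2 * i ≤ a v}
  have hF : ∀ j e, IsKFamily G j (F j e) := fun j e => ⟨_, fun i => hanti _, rfl⟩
  have hpt : ∀ v, a v + b v ≤ (if v ∈ F k 2 then 1 else 0) + (if v ∈ F (k + 1) 1 then 1 else 0) := by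
    intro v
    have h2 : a v + b v ≤ 2 := by simpa [w] using hab v v
    have h3 := hmb v
    have h4 := hma v
    have heven : ∀ i : ℤ, -b v < m + 2 + 2 * i → m + 2 + 2 * i ≤ a v → v ∈ F k 2 := by
      intro i hi1 hi2
      refine Set.mem_iUnion.2 ⟨⟨i.toNat, by omega⟩, ?_⟩
      have : ((i.toNat : ℕ) : ℤ) = i := by omega
      exact ⟨by simpa [this] using hi1, by simpa [this] using hi2⟩
    have hodd : ∀ i : ℤ, -b v < m + 1 + 2 * i → m + 1 + 2 * i ≤ a v → v ∈ F (k + 1) 1 := by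
      intro i hi1 hi2
      refine Set.mem_iUnion.2 ⟨⟨i.toNat, by omega⟩, ?_⟩
      have : ((i.toNat : ℕ) : ℤ) = i := by omega
      exact ⟨by simpa [this] using hi1, by simpa [this] using hi2⟩
    obtain ⟨j, hj | hj⟩ := Int.even_or_odd' (-b v - m)
    · have he := mt fun h : 2 ≤ a v + b v => heven j (by omega) (by omega)
      have ho := mt fun h : 1 ≤ a v + b v => hodd j (by omega) (by omega)
      split_ifs with h5 h6 h6
      · omega
      · have := ho h6
        omega
      · have := he h5
        omega
      · have := ho h6
        omega
    · have he := mt fun h : 1 ≤ a v + b v => heven j (by omega) (by omega)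
      have ho := mt fun h : 2 ≤ a v + b v => hodd (j + 1) (by omega) (by omega)
      split_ifs with h5 h6 h6
      · omega
      · have := ho h6
        omega
      · have := he h5
        omega
      · have := he h5
        omega
  have hle : ∑ v, (a v + b v) ≤ (((F k 2).ncard + (F (k + 1) 1).ncard : ℕ) : ℤ) := by
    refine (Finset.sum_le_sum fun v _ => hpt v).trans (le_of_eq ?_)
    rw [Finset.sum_add_distrib, Finset.sum_boole, Finset.sum_boole, Nat.cast_add]
    congr 2 <;> rw [Set.ncard_eq_toFinset_card'] <;> congr 1 <;> ext v <;> simp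
  have h1 := (hF k 2).ncard_le_alphak
  have h2 := (hF (k + 1) 1).ncard_le_alphak
  have h3 := alphak_le_knorm hf k
  have h4 := alphak_le_knorm hf (k + 1)
  refine ⟨f, hf, ?_, ?_⟩ <;> omega

theorem IsComparabilityGraph.sgk {V : Type*} [Fintype V] {G : SimpleGraph V}
    (hG : IsComparabilityGraph G) : SGK G := by
  obtain ⟨r, hr, hG⟩ := hG
  intro s k hk
  let _ : PartialOrder (↑s : Set V) :=
    { le := fun v w => r v w
      le_refl := fun v => hr.refl v
      le_trans := fun u v w => hr.trans u v w
      le_antisymm := fun v w h1 h2 => Subtype.ext (hr.antisymm _ _ h1 h2) }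
  refine exists_saturated_of_partialOrder (G.induce ↑s) (fun v w => ?_) hk
  rw [SimpleGraph.comap_adj]
  exact (hG v w).trans (and_congr_left' (not_congr Subtype.ext_iff.symm))

end GreeneKleitman

section Invariants

variable {V W : Type*} {G : SimpleGraph V} {H : SimpleGraph W}

lemma indepSet_compl_iff {s : Set V} : IndepSet Gᶜ s ↔ G.IsClique s := by
  constructor
  · intro h v hv w hw hne
    by_contra hadj
    exact h hv hw (by simp [hne, hadj])
  · intro h v hv w hw hadj
    rw [SimpleGraph.compl_adj] at hadj
    exact hadj.2 (h hv hw hadj.1)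

lemma indepNumber_compl (G : SimpleGraph V) : indepNumber Gᶜ = cliqueNumber G := by
  simp only [indepNumber, cliqueNumber, indepSet_compl_iff]

lemma cliqueNumber_compl (G : SimpleGraph V) : cliqueNumber Gᶜ = indepNumber G := by
  rw [← indepNumber_compl, compl_compl]

lemma alphak_one (G : SimpleGraph V) : alphak G 1 = indepNumber G := by
  rw [alphak, indepNumber]
  congr 1
  ext n
  constructor
  · rintro ⟨A, hA, h⟩
    exact ⟨A 0, hA 0, by rwa [show ⋃ i, A i = A 0 by ext; simp] at h⟩
  · rintro ⟨s, hs, h⟩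
    exact ⟨fun _ => s, fun _ => hs, by simpa [Set.iUnion_const] using h⟩

lemma exists_isClique_ncard_eq [Finite V] (G : SimpleGraph V) :
    ∃ K : Set V, G.IsClique K ∧ K.ncard = cliqueNumber G := by
  have := Fintype.ofFinite V
  refine Nat.sSup_mem (s := {n | ∃ s : Set V, G.IsClique s ∧ s.ncard = n})
    ⟨0, ∅, by simp, by simp⟩ ⟨Fintype.card V, ?_⟩
  rintro _ ⟨s, -, rfl⟩
  exact ncard_le_fintype_card s

lemma cliqueNumber_eq {m : ℕ} {K : Set V} (hK : G.IsClique K) (hKm : m ≤ K.ncard)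
    (h : ∀ s : Set V, G.IsClique s → s.ncard ≤ m) : cliqueNumber G = m := by
  refine IsGreatest.csSup_eq ⟨⟨K, hK, le_antisymm (h K hK) hKm⟩, ?_⟩
  rintro _ ⟨s, hs, rfl⟩
  exact h s hs

lemma ncard_le_cliqueNumber [Finite V] {K : Set V} (hK : G.IsClique K) :
    K.ncard ≤ cliqueNumber G := by
  have := Fintype.ofFinite V
  refine le_csSup ⟨Fintype.card V, ?_⟩ ⟨K, hK, rfl⟩
  rintro _ ⟨s, -, rfl⟩
  exact ncard_le_fintype_card s

lemma isClique_image_iso (e : G ≃g H) {s : Set V} (hs : G.IsClique s) : H.IsClique (e '' s) := by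
  rintro _ ⟨v, hv, rfl⟩ _ ⟨w, hw, rfl⟩ hne
  exact e.map_adj_iff.2 (hs hv hw fun h => hne (h ▸ rfl))

lemma IsKFamily.image_iso {k : ℕ} {F : Set V} (hF : IsKFamily G k F) (e : G ≃g H) :
    IsKFamily H k (e '' F) := by
  obtain ⟨A, hA, rfl⟩ := hF
  refine ⟨fun i => e '' A i, fun i => ?_, by rw [Set.image_iUnion]⟩
  rintro _ ⟨v, hv, rfl⟩ _ ⟨w, hw, rfl⟩ hadj
  exact hA i hv hw (e.map_adj_iff.1 hadj)

lemma preimage_conj_singleton (e : V ≃ W) (f : V → V) (v : V) :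
    (e ∘ f ∘ e.symm) ⁻¹' {e v} = e '' (f ⁻¹' {v}) := by
  ext w
  simp [Equiv.image_eq_preimage_symm]

lemma IsCliquePartition.conj_iso {f : V → V} (hf : IsCliquePartition G f) (e : G ≃g H) :
    IsCliquePartition H (e.toEquiv ∘ f ∘ e.toEquiv.symm) := by
  intro w
  obtain ⟨v, rfl⟩ := e.toEquiv.surjective w
  rw [preimage_conj_singleton]
  exact isClique_image_iso e (hf v)

variable [Fintype V] [Fintype W]

lemma alphak_le_of_iso (e : G ≃g H) (k : ℕ) : alphak G k ≤ alphak H k := by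
  obtain ⟨F, hF, h⟩ := exists_isKFamily_ncard_eq_alphak G k
  rw [← h, ← Set.ncard_image_of_injective F e.injective]
  exact (hF.image_iso e).ncard_le_alphak

lemma alphak_iso (e : G ≃g H) (k : ℕ) : alphak G k = alphak H k :=
  le_antisymm (alphak_le_of_iso e k) (alphak_le_of_iso e.symm k)

lemma cliqueNumber_le_of_iso (e : G ≃g H) : cliqueNumber G ≤ cliqueNumber H := by
  obtain ⟨K, hK, h⟩ := exists_isClique_ncard_eq G
  rw [← h, ← Set.ncard_image_of_injective K e.injective]
  exact ncard_le_cliqueNumber (isClique_image_iso e hK)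

lemma cliqueNumber_iso (e : G ≃g H) : cliqueNumber G = cliqueNumber H :=
  le_antisymm (cliqueNumber_le_of_iso e) (cliqueNumber_le_of_iso e.symm)

lemma knorm_conj (e : V ≃ W) (f : V → V) (k : ℕ) : knorm (e ∘ f ∘ e.symm) k = knorm f k := by
  rw [knorm, ← Equiv.sum_comp e, knorm]
  refine Finset.sum_congr rfl fun v _ => ?_
  rw [preimage_conj_singleton, Set.ncard_image_of_injective _ e.injective]

lemma PolyunsatG.iso (hG : PolyunsatG G) (e : G ≃g H) : PolyunsatG H := by
  rintro k l hk hl hka hla hkl ⟨f, hf, h1, h2⟩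
  rw [← cliqueNumber_iso e] at hka hla
  refine hG k l hk hl hka hla hkl ⟨_, hf.conj_iso e.symm, ?_, ?_⟩
  · rw [knorm_conj, h1, alphak_iso e]
  · rw [knorm_conj, h2, alphak_iso e]

lemma SGK.exists_saturated (hG : SGK G) {k : ℕ} (hk : 0 < k) :
    ∃ f : V → V, IsCliquePartition G f ∧ knorm f k = alphak G k ∧
      knorm f (k + 1) = alphak G (k + 1) := by
  obtain ⟨f, hf, h1, h2⟩ := hG Finset.univ k hk
  let e : G.induce (↑(Finset.univ : Finset V) : Set V) ≃g G :=
    { toEquiv := Equiv.subtypeUnivEquiv (by simp)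
      map_rel_iff' := Iff.rfl }
  refine ⟨_, hf.conj_iso e, ?_, ?_⟩
  · rw [knorm_conj, h1, alphak_iso e]
  · rw [knorm_conj, h2, alphak_iso e]

end Invariants

section Necessity

variable {V : Type*} [Fintype V] {G : SimpleGraph V}

lemma knorm_concave (f : V → V) (k : ℕ) :
    knorm f k + knorm f (k + 2) ≤ 2 * knorm f (k + 1) := by
  rw [knorm, knorm, knorm, ← Finset.sum_add_distrib, Finset.mul_sum]
  exact Finset.sum_le_sum fun i _ => by omega

lemma knorm_eq_card {f : V → V} (hf : IsCliquePartition G f) :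
    knorm f (cliqueNumber G) = Fintype.card V := by
  rw [← Nat.card_eq_fintype_card, ← Set.ncard_univ,
    ncard_eq_sum_fibers f Finset.univ (fun _ => Finset.mem_univ _), knorm]
  refine Finset.sum_congr rfl fun i _ => ?_
  rw [Set.univ_inter, min_eq_right (ncard_le_cliqueNumber (hf i))]

lemma alphak_lt_card {k : ℕ} (hk : k < cliqueNumber G) : alphak G k < Fintype.card V := by
  obtain ⟨F, hF, h⟩ := exists_isKFamily_ncard_eq_alphak G k
  obtain ⟨K, hK, hKc⟩ := exists_isClique_ncard_eq G
  rw [← h]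
  refine lt_of_le_of_ne (ncard_le_fintype_card F) fun hcard => ?_
  have hF' : F = Set.univ := by
    refine Set.eq_of_subset_of_ncard_le (Set.subset_univ F) ?_
    rw [hcard, Set.ncard_univ, Nat.card_eq_fintype_card]
  have := hF.ncard_inter_le hK
  rw [hF', Set.univ_inter] at this
  omega

theorem bounds_of_polyunsatG (hS : SGK G) (hP : PolyunsatG G) {a : ℕ} (ha : 3 ≤ a)
    (hω : cliqueNumber G = a) :
    a ≤ alphak G 1 + 2 ∧ alphak G 1 + 1 + (a - 1).choose 2 ≤ Fintype.card V ∧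
      Fintype.card V + (a - 1).choose 2 ≤ a * alphak G 1 + 1 := by
  obtain ⟨α, hα⟩ : ∃ α, α = alphak G := ⟨_, rfl⟩
  obtain ⟨n, hn⟩ : ∃ n, n = Fintype.card V := ⟨_, rfl⟩
  rw [← hα, ← hn]
  have hstrict : ∀ k, 1 ≤ k → k + 2 < a → α k + α (k + 2) + 1 ≤ 2 * α (k + 1) := by
    intro k hk hka
    obtain ⟨f, hf, h1, h2⟩ := hS.exists_saturated (k := k + 1) (by omega)
    have h3 := hP k (k + 2) (by omega) (by omega) (by omega) (by omega) (by omega)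
    have h4 := alphak_le_knorm hf k
    have h5 := knorm_concave f k
    have h6 : knorm f k ≠ alphak G k := fun h => h3 ⟨f, hf, h, h2⟩
    have h7 : knorm f (k + 2) = alphak G (k + 2) := h2
    rw [← hα] at h1 h4 h6 h7
    omega
  have hfirst : α 2 ≤ 2 * α 1 := by
    obtain ⟨f, hf, h1, h2⟩ := hS.exists_saturated (k := 1) (by omega)
    have := knorm_concave f 0
    have h0 : knorm f 0 = 0 := by simp [knorm]
    rw [← hα] at h1 h2
    simp only [Nat.reduceAdd] at *
    omega
  have hlast : α (a - 2) + n ≤ 2 * α (a - 1) := by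
    obtain ⟨f, hf, h1, h2⟩ := hS.exists_saturated (k := a - 1) (by omega)
    have h3 := knorm_concave f (a - 2)
    have h4 := alphak_le_knorm hf (a - 2)
    have h5 := knorm_eq_card hf
    rw [hω, ← hn] at h5
    have e1 : a - 2 + 1 = a - 1 := by omega
    have e2 : a - 2 + 2 = a := by omega
    rw [e1, e2] at h3
    rw [← hα] at h1 h4
    omega
  have hlt : α (a - 1) < n := by
    rw [hα, hn]
    exact alphak_lt_card (by omega)
  have hup : ∀ k, k + 2 ≤ a - 1 → α (k + 2) + k ≤ α (k + 1) + α 1 ∧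
      α (k + 2) + (k + 1).choose 2 ≤ (k + 2) * α 1 := by
    intro k
    induction k with
    | zero =>
      intro _
      simp
      omega
    | succ k ih =>
      intro hk
      obtain ⟨h1, h2⟩ := ih (by omega)
      have h3 := hstrict (k + 1) (by omega) (by omega)
      have h4 : (k + 1 + 1).choose 2 = (k + 1) + (k + 1).choose 2 := by
        rw [Nat.choose_succ_succ' (k + 1) 1, Nat.choose_one_right]
      have h5 : (k + 1 + 2) * α 1 = (k + 2) * α 1 + α 1 := by ring
      simp only [add_assoc, Nat.reduceAdd] at *
      omega
  have hdown : ∀ j, j + 1 ≤ a - 2 → α (a - 2 - j) + (j + 1) ≤ α (a - 1 - j) ∧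
      α (a - 2 - j) + (j + 2).choose 2 ≤ α (a - 1) := by
    intro j
    induction j with
    | zero =>
      intro _
      simp
      omega
    | succ j ih =>
      intro hj
      obtain ⟨h1, h2⟩ := ih (by omega)
      have h3 := hstrict (a - 2 - (j + 1)) (by omega) (by omega)
      have e1 : a - 2 - (j + 1) + 1 = a - 2 - j := by omega
      have e2 : a - 2 - (j + 1) + 2 = a - 1 - j := by omega
      have e3 : a - 1 - (j + 1) = a - 2 - j := by omega
      rw [e1, e2] at h3
      rw [e3]
      have h4 : (j + 1 + 2).choose 2 = (j + 2) + (j + 2).choose 2 := by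
        rw [show j + 1 + 2 = j + 2 + 1 by omega, Nat.choose_succ_succ' (j + 2) 1,
          Nat.choose_one_right]
      omega
  obtain ⟨b, rfl⟩ : ∃ b, a = b + 3 := ⟨a - 3, by omega⟩
  have hu := hup b (by omega)
  have hd := hdown b (by omega)
  rw [show b + 3 - 2 - b = 1 by omega, show b + 3 - 1 - b = 2 by omega] at hd
  rw [show b + 3 - 1 = b + 2 by omega] at *
  rw [show b + 3 - 2 = b + 1 by omega] at hlast
  have h4 : (b + 2).choose 2 = (b + 1) + (b + 1).choose 2 := by
    rw [Nat.choose_succ_succ' (b + 1) 1, Nat.choose_one_right]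
  have h5 : (b + 3) * α 1 = (b + 2) * α 1 + α 1 := by ring
  refine ⟨?_, ?_, ?_⟩ <;> omega

end Necessity

section Construction

lemma alphak_eq_of_rank {V β : Type*} [Fintype V] {G : SimpleGraph V} (g : V → β) (ρ : V → ℕ)
    {k : ℕ} (hg : ∀ v u, g v = g u → v ≠ u → G.Adj v u) (hρ : ∀ v u, ρ v = ρ u → ¬ G.Adj v u)
    (h : ∀ v, ¬ (1 ≤ ρ v ∧ ρ v ≤ k) → ∀ r, 1 ≤ r → r ≤ k → ∃ u, g u = g v ∧ ρ u = r) :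
    IsKFamily G k {v | 1 ≤ ρ v ∧ ρ v ≤ k} ∧
      {v | 1 ≤ ρ v ∧ ρ v ≤ k}.ncard = alphak G k := by
  classical
  have hR : IsKFamily G k {v | 1 ≤ ρ v ∧ ρ v ≤ k} := by
    refine ⟨fun i => {v | ρ v = i + 1}, fun i v hv u hu => hρ v u (hv.trans hu.symm), ?_⟩
    ext v
    simp only [Set.mem_iUnion, Set.mem_ofPred_eq]
    constructor
    · rintro ⟨i, hi⟩
      omega
    · intro hv
      exact ⟨⟨ρ v - 1, by omega⟩, by simp; omega⟩
  refine ⟨hR, le_antisymm hR.ncard_le_alphak ?_⟩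
  obtain ⟨F, hF, hFc⟩ := exists_isKFamily_ncard_eq_alphak G k
  have hS : ∀ v, g v ∈ Finset.univ.image g := fun v => Finset.mem_image_of_mem g (Finset.mem_univ v)
  rw [← hFc, ncard_eq_sum_fibers g _ hS, ncard_eq_sum_fibers g _ hS]
  refine Finset.sum_le_sum fun b _ => ?_
  have hK : G.IsClique (g ⁻¹' {b}) := fun v hv u hu hne => hg v u (hv.trans hu.symm) hne
  by_cases hsub : g ⁻¹' {b} ⊆ {v | 1 ≤ ρ v ∧ ρ v ≤ k}
  · exact Set.ncard_le_ncard fun v hv => ⟨hsub hv.2, hv.2⟩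
  · obtain ⟨v, hv, hvR⟩ := Set.not_subset.1 hsub
    have hsurj : (↑(Finset.Icc 1 k) : Set ℕ) ⊆
        ρ '' ({v | 1 ≤ ρ v ∧ ρ v ≤ k} ∩ g ⁻¹' {b}) := by
      intro r hr
      rw [Finset.coe_Icc, Set.mem_Icc] at hr
      obtain ⟨u, hu, rfl⟩ := h v hvR r hr.1 hr.2
      exact ⟨u, ⟨hr, hu.trans hv⟩, rfl⟩
    have h1 := Set.ncard_le_ncard hsurj
    rw [Set.ncard_coe_finset, Nat.card_Icc] at h1
    have h2 := Set.ncard_image_le (f := ρ) (s := {v | 1 ≤ ρ v ∧ ρ v ≤ k} ∩ g ⁻¹' {b})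
    have h3 := hF.ncard_inter_le hK
    omega

/-- The vertices `(i, s)`, where `i` is the index of a chain and `s` is the rank: the `i`-th of
the `c` chains has the ranks `1, …, L i`, and the first chain has an additional vertex of
rank `0`. -/
def towerVertices (c : ℕ) (L : ℕ → ℕ) : Finset (Σ _ : ℕ, ℕ) :=
  insert ⟨1, 0⟩ ((Finset.Icc 1 c).sigma fun i => Finset.Icc 1 (L i))

lemma mem_towerVertices {c : ℕ} {L : ℕ → ℕ} {p : Σ _ : ℕ, ℕ} :
    p ∈ towerVertices c L ↔
      (p.1 = 1 ∧ p.2 = 0) ∨ ((1 ≤ p.1 ∧ p.1 ≤ c) ∧ 1 ≤ p.2 ∧ p.2 ≤ L p.1) := by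
  obtain ⟨i, s⟩ := p
  simp [towerVertices]

lemma card_towerVertices (c : ℕ) (L : ℕ → ℕ) :
    (towerVertices c L).card = ∑ i ∈ Finset.Icc 1 c, L i + 1 := by
  rw [towerVertices, Finset.card_insert_of_notMem (by simp), Finset.card_sigma]
  simp

/-- The order on pairs (chain, rank) underlying the construction: besides the chains themselves,
the ranks at most `i` of chain `i` lie below the ranks at least `j` of chain `j`
for `i < j ≤ w`. -/
def TowerLT (w : ℕ) (p q : Σ _ : ℕ, ℕ) : Prop :=
  (p.1 = q.1 ∧ p.2 < q.2) ∨ (p.1 < q.1 ∧ q.1 ≤ w ∧ p.2 ≤ p.1 ∧ q.1 ≤ q.2)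

/-- The comparability graph of `TowerLT w` on `towerVertices c L`. -/
def towerGraph (w c : ℕ) (L : ℕ → ℕ) : SimpleGraph (towerVertices c L) where
  Adj p q := TowerLT w p q ∨ TowerLT w q p
  symm := ⟨fun _ _ h => h.symm⟩
  loopless := ⟨fun p h => by simp [TowerLT] at h⟩

variable {w c : ℕ} {L : ℕ → ℕ}

lemma towerGraph_adj {p q : towerVertices c L} :
    (towerGraph w c L).Adj p q ↔ TowerLT w p q ∨ TowerLT w q p := Iff.rfl

lemma isComparabilityGraph_towerGraph (w c : ℕ) (L : ℕ → ℕ) :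
    IsComparabilityGraph (towerGraph w c L) := by
  refine ⟨fun p q => p = q ∨ TowerLT w p q, ?_, fun p q => ?_⟩
  · refine { refl := fun p => Or.inl rfl, trans := ?_, antisymm := ?_ }
    · rintro p q r (rfl | h1) (rfl | h2)
      · exact Or.inl rfl
      · exact Or.inr h2
      · exact Or.inr h1
      · right
        simp only [TowerLT] at *
        omega
    · rintro p q (h | h1) (h' | h2)
      · exact h
      · exact h
      · exact h'.symm
      · simp only [TowerLT] at *
        omega
  · rw [towerGraph_adj]
    by_cases h : p = q
    · subst h
      simp [TowerLT]
    · simp [h, Ne.symm h]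

lemma tower_ext {p q : towerVertices c L} (h1 : p.1.1 = q.1.1) (h2 : p.1.2 = q.1.2) : p = q :=
  Subtype.ext (Sigma.ext h1 (heq_of_eq h2))

lemma isComparabilityGraph_compl_towerGraph (w c : ℕ) (L : ℕ → ℕ) :
    IsComparabilityGraph (towerGraph w c L)ᶜ := by
  refine ⟨fun p q => p = q ∨ (p.1.1 < q.1.1 ∧ ¬ TowerLT w p q), ?_, fun p q => ?_⟩
  · refine { refl := fun p => Or.inl rfl, trans := ?_, antisymm := ?_ }
    · rintro p q r (rfl | h1) (rfl | h2)
      · exact Or.inl rfl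
      · exact Or.inr h2
      · exact Or.inr h1
      · right
        simp only [TowerLT] at *
        omega
    · rintro p q (h | h1) (h' | h2)
      · exact h
      · exact h
      · exact h'.symm
      · omega
  · rw [SimpleGraph.compl_adj, towerGraph_adj]
    refine and_congr_right fun h => ?_
    have hne : ¬ (p.1.1 = q.1.1 ∧ p.1.2 = q.1.2) := fun h' => h (tower_ext h'.1 h'.2)
    simp only [h, Ne.symm h, false_or, TowerLT]
    omega

variable (hw : 1 ≤ w) (hwc : w ≤ c) (hL : ∀ i, 1 ≤ i → i ≤ w → L i = i + 1)
  (hL' : ∀ i, w < i → i ≤ c → 1 ≤ L i ∧ L i ≤ w + 2)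

include hL in
lemma tower_bounds (p : towerVertices c L) : 1 ≤ p.1.1 ∧ (p.1.2 = 0 → p.1.1 = 1) ∧
    (p.1.1 ≤ w → p.1.2 ≤ p.1.1 + 1) ∧ (p.1.2 = 0 ∨ (p.1.1 ≤ c ∧ p.1.2 ≤ L p.1.1)) := by
  have h := mem_towerVertices.1 p.2
  have h' := hL p.1.1
  omega

include hL hL'

lemma exists_tower (i s : ℕ) (hi : 1 ≤ i) (hic : i ≤ c)
    (hs : (i = 1 ∧ s = 0) ∨ (1 ≤ s ∧ (i ≤ w → s ≤ i + 1) ∧ (w < i → s ≤ 1))) :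
    ∃ p : towerVertices c L, p.1.1 = i ∧ p.1.2 = s := by
  refine ⟨⟨⟨i, s⟩, mem_towerVertices.2 ?_⟩, rfl, rfl⟩
  have := hL i
  have := hL' i
  dsimp only
  omega

include hw hwc

lemma indepNumber_towerGraph : indepNumber (towerGraph w c L) = c := by
  rw [← cliqueNumber_compl]
  have hex : ∀ i : ℕ, ∃ p : towerVertices c L, 1 ≤ i → i ≤ c → p.1.1 = i ∧ p.1.2 = 1 := by
    intro i
    by_cases hi : 1 ≤ i ∧ i ≤ c
    · obtain ⟨p, hp⟩ := exists_tower hL hL' i 1 hi.1 hi.2 (by omega)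
      exact ⟨p, fun _ _ => hp⟩
    · obtain ⟨p, -⟩ := exists_tower hL hL' 1 0 le_rfl (by omega) (by omega)
      exact ⟨p, fun h1 h2 => absurd ⟨h1, h2⟩ hi⟩
  choose e he using hex
  refine cliqueNumber_eq (K := e '' (Finset.Icc 1 c : Finset ℕ)) ?_ ?_ ?_
  · rintro _ ⟨i, hi, rfl⟩ _ ⟨j, hj, rfl⟩ hne
    simp only [Finset.coe_Icc, Set.mem_Icc] at hi hj
    have hi := he i hi.1 hi.2
    have hj := he j hj.1 hj.2
    rw [SimpleGraph.compl_adj, towerGraph_adj]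
    refine ⟨hne, ?_⟩
    simp only [TowerLT]
    omega
  · rw [Set.InjOn.ncard_image, Set.ncard_coe_finset, Nat.card_Icc]
    · omega
    · intro i hi j hj hij
      simp only [Finset.coe_Icc, Set.mem_Icc] at hi hj
      have hi := he i hi.1 hi.2
      have hj := he j hj.1 hj.2
      rw [hij] at hi
      omega
  · intro s hs
    have := Set.ncard_le_ncard_of_injOn (s := s) (t := (Finset.Icc 1 c : Finset ℕ))
      (fun p => p.1.1) (fun p _ => by
        have := tower_bounds hL p
        simp only [Finset.coe_Icc, Set.mem_Icc]
        omega) (fun p hp q hq hpq => by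
        by_contra hne
        have h := hs hp hq hne
        rw [SimpleGraph.compl_adj, towerGraph_adj] at h
        have hne' : ¬ (p.1.1 = q.1.1 ∧ p.1.2 = q.1.2) := fun h' => hne (tower_ext h'.1 h'.2)
        simp only [TowerLT] at h hpq
        omega)
    rwa [Set.ncard_coe_finset, Nat.card_Icc, Nat.add_sub_cancel] at this

lemma cliqueNumber_towerGraph : cliqueNumber (towerGraph w c L) = w + 2 := by
  have hex : ∀ s : ℕ, ∃ p : towerVertices c L, s ≤ w + 1 →
      (s = 0 → p.1.1 = 1) ∧ (1 ≤ s → s ≤ w → p.1.1 = s) ∧ (s = w + 1 → p.1.1 = w) ∧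
        p.1.2 = s := by
    intro s
    by_cases hs : s ≤ w + 1
    · obtain ⟨p, hp⟩ := exists_tower hL hL' (max 1 (min s w)) s (by omega) (by omega)
        (by omega)
      exact ⟨p, fun _ => by omega⟩
    · obtain ⟨p, -⟩ := exists_tower hL hL' 1 0 le_rfl (by omega) (by omega)
      exact ⟨p, fun h => absurd h hs⟩
  choose e he using hex
  refine cliqueNumber_eq (K := e '' (Finset.range (w + 2) : Finset ℕ)) ?_ ?_ ?_
  · rintro _ ⟨i, hi, rfl⟩ _ ⟨j, hj, rfl⟩ hne
    simp only [Finset.coe_range, Set.mem_Iio] at hi hj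
    have hij : i ≠ j := fun h => hne (h ▸ rfl)
    have hi := he i (by omega)
    have hj := he j (by omega)
    rw [towerGraph_adj]
    simp only [TowerLT]
    omega
  · rw [Set.InjOn.ncard_image, Set.ncard_coe_finset, Finset.card_range]
    intro i hi j hj hij
    simp only [Finset.coe_range, Set.mem_Iio] at hi hj
    have hi := he i (by omega)
    have hj := he j (by omega)
    rw [hij] at hi
    omega
  · intro s hs
    have hinj : Set.InjOn (fun p : towerVertices c L => p.1.2) s := by
      intro p hp q hq hpq
      by_contra hne
      have h := hs hp hq hne
      rw [towerGraph_adj] at h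
      simp only [TowerLT] at h hpq
      omega
    by_cases h0 : ∃ p ∈ s, p.1.2 = 0
    · obtain ⟨p, hp, hp0⟩ := h0
      have := Set.ncard_le_ncard_of_injOn (s := s) (t := (Finset.range (w + 2) : Finset ℕ))
        (fun p => p.1.2) (fun q hq => by
          have h1 := tower_bounds hL p
          have h2 := tower_bounds hL q
          simp only [Finset.coe_range, Set.mem_Iio]
          by_cases hpq : p = q
          · subst hpq
            omega
          · have h := hs hp hq hpq
            rw [towerGraph_adj] at h
            simp only [TowerLT] at h
            omega) hinj
      rwa [Set.ncard_coe_finset, Finset.card_range] at this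
    · have := Set.ncard_le_ncard_of_injOn (s := s) (t := (Finset.Icc 1 (w + 2) : Finset ℕ))
        (fun p => p.1.2) (fun q hq => by
          have h2 := tower_bounds hL q
          have h3 : q.1.2 ≠ 0 := fun h => h0 ⟨q, hq, h⟩
          have := hL' q.1.1
          simp only [Finset.coe_Icc, Set.mem_Icc]
          omega) hinj
      rwa [Set.ncard_coe_finset, Nat.card_Icc, Nat.add_sub_cancel] at this

lemma towerGraph_rank_family {k : ℕ} (hk : 1 ≤ k) (hkw : k ≤ w + 1) :
    IsKFamily (towerGraph w c L) k {v | 1 ≤ v.1.2 ∧ v.1.2 ≤ k} ∧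
      {v : towerVertices c L | 1 ≤ v.1.2 ∧ v.1.2 ≤ k}.ncard = alphak (towerGraph w c L) k := by
  obtain ⟨m, hm⟩ : ∃ m, m = min k w := ⟨_, rfl⟩
  let g : towerVertices c L → ℕ × ℕ := fun p =>
    if m < p.1.1 then (p.1.1, 0)
    else if p.1.2 = 0 ∨ p.1.2 = p.1.1 ∨ (p.1.1 = m ∧ p.1.2 = m + 1) then (0, 0)
    else if p.1.2 < p.1.1 then (p.1.1, 0) else (p.1.1, 1)
  refine alphak_eq_of_rank g (fun p => p.1.2) ?_ ?_ ?_
  · intro p q hpq hne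
    have h1 := tower_bounds hL p
    have h2 := tower_bounds hL q
    have hne' : ¬ (p.1.1 = q.1.1 ∧ p.1.2 = q.1.2) := fun h' => hne (tower_ext h'.1 h'.2)
    rw [towerGraph_adj]
    simp only [TowerLT]
    simp only [g] at hpq
    split_ifs at hpq <;> simp only [Prod.mk.injEq] at hpq <;> omega
  · intro p q hpq
    rw [towerGraph_adj]
    simp only [TowerLT]
    omega
  · intro p hp r hr hrk
    have h1 := tower_bounds hL p
    by_cases hpm : m < p.1.1
    · have hmem : (⟨p.1.1, r⟩ : Σ _ : ℕ, ℕ) ∈ towerVertices c L :=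
        mem_towerVertices.2 (by dsimp only; omega)
      refine ⟨⟨_, hmem⟩, ?_, rfl⟩
      simp only [g, if_pos hpm]
    · have hgp : g p = (0, 0) := by
        simp only [g]
        rw [if_neg hpm, if_pos (by omega)]
      obtain ⟨q, hq⟩ := exists_tower hL hL' (min r w) r (by omega) (by omega) (by omega)
      refine ⟨q, ?_, hq.2⟩
      rw [hgp]
      simp only [g]
      rw [if_neg (by omega), if_pos (by omega)]

lemma polyunsatG_towerGraph : PolyunsatG (towerGraph w c L) := by
  have main : ∀ k l : ℕ, 0 < k → k + 2 ≤ l → l < w + 2 → ∀ f : towerVertices c L → towerVertices c L,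
      IsCliquePartition (towerGraph w c L) f → knorm f k = alphak (towerGraph w c L) k →
      knorm f l = alphak (towerGraph w c L) l → False := by
    intro k l hk hkl hl f hf hfk hfl
    obtain ⟨hFk, hFkc⟩ := towerGraph_rank_family hw hwc hL hL' (k := k) (by omega) (by omega)
    obtain ⟨hFl, hFlc⟩ := towerGraph_rank_family hw hwc hL hL' (k := l) (by omega) (by omega)
    obtain ⟨x₀, hx₀⟩ := exists_tower hL hL' 1 0 le_rfl (by omega) (by omega)
    obtain ⟨x, hx⟩ := exists_tower hL hL' k k (by omega) (by omega) (by omega)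
    obtain ⟨t, ht⟩ := exists_tower hL hL' k (k + 1) (by omega) (by omega) (by omega)
    set D := f ⁻¹' {f x₀} with hD
    have hDcl : (towerGraph w c L).IsClique D := hf (f x₀)
    have hx₀D : x₀ ∈ D := rfl
    have hadj : ∀ p ∈ D, ∀ q ∈ D, ¬ (p.1.1 = q.1.1 ∧ p.1.2 = q.1.2) →
        TowerLT w p q ∨ TowerLT w q p := by
      intro p hp q hq hne
      exact hDcl hp hq fun h => hne (h ▸ ⟨rfl, rfl⟩)
    have hcard : ({v : towerVertices c L | 1 ≤ v.1.2 ∧ v.1.2 ≤ l} ∩ D).ncard = l := by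
      have h := hFl.ncard_inter_fiber_eq hf (hFlc.trans hfl.symm) (f x₀)
      have hlt : ({v : towerVertices c L | 1 ≤ v.1.2 ∧ v.1.2 ≤ l} ∩ D).ncard < D.ncard := by
        refine Set.ncard_lt_ncard ⟨Set.inter_subset_right, fun hsub => ?_⟩
        have := (hsub hx₀D).1.1
        omega
      rw [← hD] at h
      omega
    have hrank : ∀ r, 1 ≤ r → r ≤ l → ∃ p ∈ D, p.1.2 = r := by
      have himg : (fun p : towerVertices c L => p.1.2) ''
          ({v : towerVertices c L | 1 ≤ v.1.2 ∧ v.1.2 ≤ l} ∩ D) = ↑(Finset.Icc 1 l) := by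
        refine Set.eq_of_subset_of_ncard_le ?_ ?_ (Finset.finite_toSet _)
        · rintro _ ⟨p, hp, rfl⟩
          simpa using hp.1
        · rw [Set.InjOn.ncard_image, hcard, Set.ncard_coe_finset, Nat.card_Icc]
          · omega
          · intro p hp q hq hpq
            by_contra hne
            have h := hDcl hp.2 hq.2 hne
            rw [towerGraph_adj] at h
            simp only [TowerLT] at h hpq
            omega
      intro r hr hrl
      have : r ∈ (↑(Finset.Icc 1 l) : Set ℕ) := by simp [hr, hrl]
      rw [← himg] at this
      obtain ⟨p, hp, hpr⟩ := this
      exact ⟨p, hp.2, hpr⟩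
    have hxD : x ∈ D := by
      obtain ⟨p, hp, hpr⟩ := hrank k (by omega) (by omega)
      obtain ⟨q, hq, hqr⟩ := hrank (k + 1) (by omega) (by omega)
      have h1 := hadj x₀ hx₀D p hp (by omega)
      have h2 := hadj p hp q hq (by omega)
      have h3 := tower_bounds hL p
      have h4 := tower_bounds hL q
      have h5 : x = p := by
        simp only [TowerLT] at h1 h2
        refine tower_ext ?_ ?_ <;> omega
      exact h5 ▸ hp
    have htD : t ∉ D := by
      intro htD
      obtain ⟨q, hq, hqr⟩ := hrank (k + 2) (by omega) (by omega)
      have h2 := hadj t htD q hq (by omega)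
      have h4 := tower_bounds hL q
      simp only [TowerLT] at h2
      omega
    set R := {v : towerVertices c L | 1 ≤ v.1.2 ∧ v.1.2 ≤ k} with hR
    have htR : t ∉ R := by
      intro h
      have := h.2
      omega
    have hxR : x ∈ R := by
      rw [hR, Set.mem_ofPred_eq]
      omega
    have hF' : IsKFamily (towerGraph w c L) k (insert t (R \ {x})) := by
      refine ⟨fun i => {v | (v.1.2 = i + 1 ∧ v ≠ x) ∨ (v = t ∧ i.1 + 1 = k)}, ?_, ?_⟩
      · rintro i p hp q hq h
        have hne : p ≠ q := h.ne
        have hb1 := tower_bounds hL p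
        have hb2 := tower_bounds hL q
        rw [towerGraph_adj] at h
        simp only [TowerLT] at h
        rcases hp with ⟨hp, hpx⟩ | ⟨rfl, hp⟩ <;> rcases hq with ⟨hq, hqx⟩ | ⟨rfl, hq⟩
        · omega
        · have : ¬ (p.1.1 = x.1.1 ∧ p.1.2 = x.1.2) := fun h' => hpx (tower_ext h'.1 h'.2)
          omega
        · have : ¬ (q.1.1 = x.1.1 ∧ q.1.2 = x.1.2) := fun h' => hqx (tower_ext h'.1 h'.2)
          omega
        · exact hne rfl
      · ext v
        simp only [Set.mem_iUnion, Set.mem_ofPred_eq, Set.mem_insert_iff, Set.mem_sdiff,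
          Set.mem_singleton_iff, hR]
        constructor
        · rintro ⟨i, ⟨h1, h2⟩ | ⟨h1, h2⟩⟩
          · exact Or.inr ⟨by omega, h2⟩
          · exact Or.inl h1
        · rintro (h | ⟨h1, h2⟩)
          · exact ⟨⟨k - 1, by omega⟩, Or.inr ⟨h, by simp; omega⟩⟩
          · exact ⟨⟨v.1.2 - 1, by omega⟩, Or.inl ⟨by simp; omega, h2⟩⟩
    have hF'c : (insert t (R \ {x})).ncard = R.ncard := by
      rw [Set.ncard_insert_of_notMem fun h => htR h.1, Set.ncard_sdiff_singleton_add_one hxR]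
    have h1 := hFk.ncard_inter_fiber_eq hf (hFkc.trans hfk.symm) (f x₀)
    have h2 := hF'.ncard_inter_fiber_eq hf ((hF'c.trans hFkc).trans hfk.symm) (f x₀)
    have h3 : (insert t (R \ {x}) ∩ D).ncard < (R ∩ D).ncard := by
      refine Set.ncard_lt_ncard ⟨?_, fun hsub => ?_⟩
      · rintro v ⟨rfl | hv, hvD⟩
        · exact absurd hvD htD
        · exact ⟨hv.1, hvD⟩
      · rcases (hsub ⟨hxR, hxD⟩).1 with h | h
        · exact htR (h ▸ hxR)
        · exact h.2 rfl
    rw [← hD] at h1 h2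
    omega
  rintro k l hk hl hka hla hkl ⟨f, hf, hfk, hfl⟩
  rw [cliqueNumber_towerGraph hw hwc hL hL'] at hka hla
  rcases hkl with h | h
  · exact main k l hk h hla f hf hfk hfl
  · exact main l k hl h hka f hf hfl hfk

omit hw hwc hL hL'

lemma exists_bounded_sum (a d N : ℕ) (ha : 1 ≤ a) (hd : d ≤ N) (hN : N ≤ a * d) :
    ∃ ℓ : ℕ → ℕ, (∀ j, 1 ≤ ℓ j ∧ ℓ j ≤ a) ∧ ∑ j ∈ Finset.range d, ℓ j = N := by
  induction d generalizing N with
  | zero => exact ⟨fun _ => 1, fun _ => ⟨le_rfl, ha⟩, by simp; omega⟩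
  | succ d ih =>
    rw [Nat.mul_succ] at hN
    have hda : d ≤ a * d := Nat.le_mul_of_pos_left d ha
    obtain ⟨ℓ, hℓ, hsum⟩ := ih (N - min a (N - d)) (by omega) (by omega)
    refine ⟨fun j => if j = d then min a (N - d) else ℓ j, fun j => ?_, ?_⟩
    · have := hℓ j
      dsimp only
      split_ifs <;> omega
    · rw [Finset.sum_range_succ, Finset.sum_congr rfl fun j hj => if_neg (by
        have := Finset.mem_range.1 hj
        omega), hsum, if_pos rfl]
      omega

lemma sum_Icc_add_one (w : ℕ) : ∑ i ∈ Finset.Icc 1 w, (i + 1) + 1 = (w + 1).choose 2 + w + 1 := by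
  induction w with
  | zero => simp
  | succ w ih =>
    have h : (w + 1 + 1).choose 2 = (w + 1) + (w + 1).choose 2 := by
      rw [Nat.choose_succ_succ' (w + 1) 1, Nat.choose_one_right]
    rw [Finset.sum_Icc_succ_top (by omega), h]
    omega

theorem exists_polyunsatG {n w c : ℕ} (hw : 1 ≤ w) (hwc : w ≤ c)
    (h1 : c + 1 + (w + 1).choose 2 ≤ n) (h2 : n + (w + 1).choose 2 ≤ (w + 2) * c + 1) :
    ∃ H : SimpleGraph (Fin n), IsComparabilityGraph H ∧ IsComparabilityGraph Hᶜ ∧ PolyunsatG H ∧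
      cliqueNumber H = w + 2 ∧ indepNumber H = c := by
  have hchoose : 2 * (w + 1).choose 2 = (w + 1) * w := by
    have := Nat.choose_two_right (w + 1)
    have h := Nat.even_mul_pred_self (w + 1)
    rw [Nat.add_sub_cancel] at this h
    rw [this, Nat.two_mul_div_two_of_even h]
  obtain ⟨d, rfl⟩ := Nat.exists_eq_add_of_le hwc
  obtain ⟨ℓ, hℓ, hsum⟩ := exists_bounded_sum (w + 2) d (n - ((w + 1).choose 2 + w + 1)) (by omega)
    (by omega) (by
      have e1 : (w + 2) * (w + d) = (w + 1) * w + w + (w + 2) * d := by ring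
      omega)
  let L : ℕ → ℕ := fun i => if i ≤ w then i + 1 else ℓ (i - (w + 1))
  have hL : ∀ i, 1 ≤ i → i ≤ w → L i = i + 1 := fun i _ hi => if_pos hi
  have hL' : ∀ i, w < i → i ≤ w + d → 1 ≤ L i ∧ L i ≤ w + 2 := by
    intro i hi _
    simp only [L, if_neg hi.not_ge]
    exact hℓ _
  have hcard : Fintype.card (towerVertices (w + d) L) = n := by
    rw [Fintype.card_coe, card_towerVertices]
    have e1 : ∑ i ∈ Finset.Icc 1 (w + d), L i =
        ∑ i ∈ Finset.Icc 1 w, (i + 1) + ∑ j ∈ Finset.range d, ℓ j := by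
      clear hsum h1 h2 hL' hwc
      induction d with
      | zero =>
        rw [Finset.range_zero, Finset.sum_empty, add_zero, add_zero]
        exact Finset.sum_congr rfl fun i hi => if_pos (Finset.mem_Icc.1 hi).2
      | succ d ih =>
        rw [← add_assoc, Finset.sum_Icc_succ_top (by omega), ih, Finset.sum_range_succ, add_assoc]
        congr 2
        simp only [L, if_neg (show ¬ w + d + 1 ≤ w by omega)]
        congr 1
        omega
    have := sum_Icc_add_one w
    omega
  let e : Fin n ≃ towerVertices (w + d) L := (Fintype.equivFinOfCardEq hcard).symm
  let H : SimpleGraph (Fin n) := (towerGraph w (w + d) L).comap e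
  let φ : H ≃g towerGraph w (w + d) L := SimpleGraph.Iso.comap e _
  have hcomp : ∀ G : SimpleGraph (towerVertices (w + d) L), IsComparabilityGraph G →
      IsComparabilityGraph (G.comap e) := by
    rintro G ⟨r, hr, hG⟩
    refine ⟨fun v w => r (e v) (e w), ?_, fun v w => ?_⟩
    · exact
        { refl := fun v => hr.refl _
          trans := fun u v w => hr.trans _ _ _
          antisymm := fun v w h h' => e.injective (hr.antisymm _ _ h h') }
    · rw [SimpleGraph.comap_adj, hG, e.injective.ne_iff]
  have hcompl : Hᶜ = (towerGraph w (w + d) L)ᶜ.comap e := by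
    ext v w
    simp [H]
  refine ⟨H, hcomp _ (isComparabilityGraph_towerGraph _ _ _), ?_,
    (polyunsatG_towerGraph hw hwc hL hL').iso φ.symm, ?_, ?_⟩
  · rw [hcompl]
    exact hcomp _ (isComparabilityGraph_compl_towerGraph _ _ _)
  · rw [cliqueNumber_iso φ, cliqueNumber_towerGraph hw hwc hL hL']
  · rw [← alphak_one, alphak_iso φ, alphak_one, indepNumber_towerGraph hw hwc hL hL']

end Construction

/-- For positive integers `n, a, c` with `a ≥ 3`: there is an `n`-vertex
co-polyunsaturated SGK graph with independence number `a` and clique number `c` iff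
`c ≥ a - 2`, `n ≥ c + 1 + (a-1).choose 2` and `n ≤ a * c + 1 - (a-1).choose 2`; moreover,
in that case the graph may be chosen so that it and its complement are comparability
graphs. -/
theorem statement16 (n a c : ℕ) (hn : 0 < n) (ha : 3 ≤ a) (hc : 0 < c) :
    ((∃ G : SimpleGraph (Fin n),
        SGK G ∧ SGK Gᶜ ∧ PolyunsatG Gᶜ ∧ indepNumber G = a ∧ cliqueNumber G = c) ↔
      (a ≤ c + 2 ∧ c + 1 + (a - 1).choose 2 ≤ n ∧ n + (a - 1).choose 2 ≤ a * c + 1)) ∧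
    ((a ≤ c + 2 ∧ c + 1 + (a - 1).choose 2 ≤ n ∧ n + (a - 1).choose 2 ≤ a * c + 1) →
      ∃ G : SimpleGraph (Fin n),
        SGK G ∧ SGK Gᶜ ∧ PolyunsatG Gᶜ ∧ indepNumber G = a ∧ cliqueNumber G = c ∧
        IsComparabilityGraph G ∧ IsComparabilityGraph Gᶜ) := by
  have construct : (a ≤ c + 2 ∧ c + 1 + (a - 1).choose 2 ≤ n ∧ n + (a - 1).choose 2 ≤ a * c + 1) →
      ∃ G : SimpleGraph (Fin n),
        SGK G ∧ SGK Gᶜ ∧ PolyunsatG Gᶜ ∧ indepNumber G = a ∧ cliqueNumber G = c ∧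
        IsComparabilityGraph G ∧ IsComparabilityGraph Gᶜ := by
    rintro ⟨h1, h2, h3⟩
    obtain ⟨w, rfl⟩ : ∃ w, a = w + 2 := ⟨a - 2, by omega⟩
    obtain ⟨H, hH, hH', hP, hω, hα⟩ :=
      exists_polyunsatG (n := n) (w := w) (c := c) (by omega) (by omega) h2 h3
    refine ⟨Hᶜ, hH'.sgk, ?_, ?_, ?_, ?_, hH', ?_⟩
    · rw [compl_compl]
      exact hH.sgk
    · rwa [compl_compl]
    · rw [indepNumber_compl, hω]
    · rw [cliqueNumber_compl, hα]
    · rwa [compl_compl]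
  refine ⟨⟨?_, fun h => ?_⟩, construct⟩
  · rintro ⟨G, -, hS, hP, rfl, rfl⟩
    have h := bounds_of_polyunsatG hS hP ha (cliqueNumber_compl G)
    rwa [alphak_one, indepNumber_compl, Fintype.card_fin] at h
  · obtain ⟨G, h1, h2, h3, h4, h5, -⟩ := construct h
    exact ⟨G, h1, h2, h3, h4, h5⟩
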